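/- Let P(λ) = Σ_{i=0}^k λ^i A_i be an m×n matrix polynomial of grade k with m ≤ n, and let L(λ) ∈ 𝕃₂(P) have nonzero left ansatz vector w ∈ F^k. Then for any nonsingular M̂ ∈ F^{k×k} with M̂w = αe₁ for some α ≠ 0, the pencil L(λ)(M̂^T⊗I_n) has the block form λ[[αA_k, 0],[X̂₁₂, −Ẑ]] + [[Ŷ₁₁, Ẑ],[αA₀, 0]] with Ẑ ∈ F^{(k-1)m×(k-1)n}. If Ẑ has full rank, i.e. rank Ẑ = (k−1)m, then L(λ) is a strong g-linearization of P(λ). -/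

import Mathlib

noncomputable section

open Polynomial Matrix

namespace GLin

variable {F : Type*} [RCLike F]

/-! ### Matrix polynomials and pencils -/

/-- The matrix polynomial `P(λ) = ∑_{i=0}^k λ^i A_i` determined by its
coefficient matrices `A_0, …, A_k` (grade `k`). -/
def matPoly {k m n : ℕ} (A : Fin (k + 1) → Matrix (Fin m) (Fin n) F) :
    Matrix (Fin m) (Fin n) F[X] :=
  Matrix.of fun r c => ∑ i : Fin (k + 1), Polynomial.C (A i r c) * Polynomial.X ^ (i : ℕ)

/-- The matrix pencil `L(λ) = λ X + Y`. -/
def pencil {ρ γ : Type*} (Xc Yc : Matrix ρ γ F) : Matrix ρ γ F[X] :=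
  Matrix.of fun i j => Polynomial.C (Xc i j) * Polynomial.X + Polynomial.C (Yc i j)

/-- `Λ_k(λ) ⊗ I_n` where `Λ_k(λ) = (λ^{k-1}, …, λ, 1)ᵀ`. -/
def Lam (F : Type*) [RCLike F] (k n : ℕ) : Matrix (Fin k × Fin n) (Fin n) F[X] :=
  Matrix.of fun p c => if p.2 = c then Polynomial.X ^ (k - 1 - (p.1 : ℕ)) else 0

/-- `Λ_k(λ)ᵀ ⊗ I_m`. -/
def LamRow (F : Type*) [RCLike F] (k m : ℕ) : Matrix (Fin m) (Fin k × Fin m) F[X] :=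
  Matrix.of fun r p => if r = p.2 then Polynomial.X ^ (k - 1 - (p.1 : ℕ)) else 0

/-- `v ⊗ P(λ)`. -/
def vkron {k m n : ℕ} (v : Fin k → F) (P : Matrix (Fin m) (Fin n) F[X]) :
    Matrix (Fin k × Fin m) (Fin n) F[X] :=
  Matrix.of fun p c => Polynomial.C (v p.1) * P p.2 c

/-- `wᵀ ⊗ P(λ)`. -/
def wkron {k m n : ℕ} (w : Fin k → F) (P : Matrix (Fin m) (Fin n) F[X]) :
    Matrix (Fin m) (Fin k × Fin n) F[X] :=
  Matrix.of fun r q => Polynomial.C (w q.1) * P r q.2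

/-- The defining identity of `𝕃₁(P)`: `L(λ)(Λ_k(λ) ⊗ I_n) = v ⊗ P(λ)`. -/
def RightAnsatz {k m n : ℕ} (P : Matrix (Fin m) (Fin n) F[X])
    (L : Matrix (Fin k × Fin m) (Fin k × Fin n) F[X]) (v : Fin k → F) : Prop :=
  L * Lam F k n = vkron v P

/-- The defining identity of `𝕃₂(P)`: `(Λ_k(λ)ᵀ ⊗ I_m) L(λ) = wᵀ ⊗ P(λ)`. -/
def LeftAnsatz {k m n : ℕ} (P : Matrix (Fin m) (Fin n) F[X])
    (L : Matrix (Fin k × Fin m) (Fin k × Fin n) F[X]) (w : Fin k → F) : Prop :=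
  LamRow F k m * L = wkron w P

/-- The vector `α e₁ ∈ F^k`. -/
def e1 {k : ℕ} (α : F) : Fin k → F := fun i => if (i : ℕ) = 0 then α else 0

/-- `M ⊗ I_m`. -/
def kronId {k m : ℕ} (M : Matrix (Fin k) (Fin k) F) :
    Matrix (Fin k × Fin m) (Fin k × Fin m) F :=
  Matrix.of fun p q => if p.2 = q.2 then M p.1 q.1 else 0

/-! ### (strong) g-linearizations -/

/-- `diag(P(λ), I_{k-1} ⊗ I_{m,n})`. -/
def glinTarget {k m n : ℕ} (P : Matrix (Fin m) (Fin n) F[X]) :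
    Matrix (Fin k × Fin m) (Fin k × Fin n) F[X] :=
  Matrix.of fun p q =>
    if p.1 = q.1 then
      (if (p.1 : ℕ) = 0 then P p.2 q.2 else if (p.2 : ℕ) = (q.2 : ℕ) then 1 else 0)
    else 0

/-- A `km × kn` pencil (or matrix polynomial) `L` is a g-linearization of the `m × n`
matrix polynomial `P` of grade `k` if `E(λ) L(λ) G(λ) = diag(P(λ), I_{k-1} ⊗ I_{m,n})`
for unimodular `E`, `G`. -/
def IsGLin {k m n : ℕ} (P : Matrix (Fin m) (Fin n) F[X])
    (L : Matrix (Fin k × Fin m) (Fin k × Fin n) F[X]) : Prop :=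
  ∃ (E : Matrix (Fin k × Fin m) (Fin k × Fin m) F[X])
    (G : Matrix (Fin k × Fin n) (Fin k × Fin n) F[X]),
      IsUnit E.det ∧ IsUnit G.det ∧ E * L * G = glinTarget P

/-- grade-`N` reversal `rev_N P(λ) = λ^N P(1/λ)`, entrywise. -/
def revMat {ρ γ : Type*} (N : ℕ) (P : Matrix ρ γ F[X]) : Matrix ρ γ F[X] :=
  P.map fun p => Polynomial.reflect N p

/-- Strong g-linearization of the grade-`k` matrix polynomial with coefficients `A`. -/
def IsStrongGLin {k m n : ℕ} (A : Fin (k + 1) → Matrix (Fin m) (Fin n) F)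
    (L : Matrix (Fin k × Fin m) (Fin k × Fin n) F[X]) : Prop :=
  IsGLin (matPoly A) L ∧ IsGLin (revMat k (matPoly A)) (revMat 1 L)

/-! ### linearizations (rectangular, of size `(m+s) × (n+s)`) -/

/-- A matrix polynomial `L` (indexed by arbitrary finite types of cardinalities
`m + s` and `n + s`) is a linearization of `P` if, after identifying the index types
with `Fin m ⊕ Fin s` and `Fin n ⊕ Fin s`, one has `E(λ) L(λ) G(λ) = diag(P(λ), I_s)`
for unimodular `E`, `G`. -/
def IsLin {m n : ℕ} (s : ℕ) (P : Matrix (Fin m) (Fin n) F[X])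
    {ρ γ : Type*} [Fintype ρ] [DecidableEq ρ] [Fintype γ] [DecidableEq γ]
    (L : Matrix ρ γ F[X]) : Prop :=
  ∃ (er : ρ ≃ (Fin m ⊕ Fin s)) (ec : γ ≃ (Fin n ⊕ Fin s))
    (E : Matrix (Fin m ⊕ Fin s) (Fin m ⊕ Fin s) F[X])
    (G : Matrix (Fin n ⊕ Fin s) (Fin n ⊕ Fin s) F[X]),
      IsUnit E.det ∧ IsUnit G.det ∧
        E * Matrix.reindex er ec L * G = Matrix.fromBlocks P 0 0 1

/-- Strong linearization of the grade-`k` matrix polynomial with coefficients `A`. -/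
def IsStrongLin {k m n : ℕ} (s : ℕ) (A : Fin (k + 1) → Matrix (Fin m) (Fin n) F)
    {ρ γ : Type*} [Fintype ρ] [DecidableEq ρ] [Fintype γ] [DecidableEq γ]
    (L : Matrix ρ γ F[X]) : Prop :=
  IsLin s (matPoly A) L ∧ IsLin s (revMat k (matPoly A)) (revMat 1 L)

/-! ### shifted sums -/

/-- Column shifted sum `X ⊞→ Y`. -/
def colShiftSum {k m n : ℕ} (Xc Yc : Matrix (Fin k × Fin m) (Fin k × Fin n) F) :
    Matrix (Fin k × Fin m) (Fin (k + 1) × Fin n) F :=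
  Matrix.of fun p q =>
    (if h : (q.1 : ℕ) < k then Xc p (⟨(q.1 : ℕ), h⟩, q.2) else 0) +
    (if h : 0 < (q.1 : ℕ) then
        Yc p (⟨(q.1 : ℕ) - 1, by have := q.1.isLt; omega⟩, q.2)
      else 0)

/-- Row shifted sum `X ⊞↓ Y`. -/
def rowShiftSum {k m n : ℕ} (Xc Yc : Matrix (Fin k × Fin m) (Fin k × Fin n) F) :
    Matrix (Fin (k + 1) × Fin m) (Fin k × Fin n) F :=
  Matrix.of fun p q =>
    (if h : (p.1 : ℕ) < k then Xc (⟨(p.1 : ℕ), h⟩, p.2) q else 0) +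
    (if h : 0 < (p.1 : ℕ) then
        Yc (⟨(p.1 : ℕ) - 1, by have := p.1.isLt; omega⟩, p.2) q
      else 0)

/-! ### the parametrization of `𝕃₁(P)` and `𝕃₂(P)` -/

/-- `X = [v ⊗ A_k ∣ -W]`. -/
def L1X {k m n : ℕ} (A : Fin (k + 1) → Matrix (Fin m) (Fin n) F) (v : Fin k → F)
    (W : Matrix (Fin k × Fin m) (Fin (k - 1) × Fin n) F) :
    Matrix (Fin k × Fin m) (Fin k × Fin n) F :=
  Matrix.of fun p q =>
    if h : (q.1 : ℕ) = 0 then v p.1 * A (Fin.last k) p.2 q.2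
    else -W p (⟨(q.1 : ℕ) - 1, by have := q.1.isLt; omega⟩, q.2)

/-- `Y = [W + v ⊗ [A_{k-1} ⋯ A_1] ∣ v ⊗ A_0]`. -/
def L1Y {k m n : ℕ} (A : Fin (k + 1) → Matrix (Fin m) (Fin n) F) (v : Fin k → F)
    (W : Matrix (Fin k × Fin m) (Fin (k - 1) × Fin n) F) :
    Matrix (Fin k × Fin m) (Fin k × Fin n) F :=
  Matrix.of fun p q =>
    if h : (q.1 : ℕ) < k - 1 then
      W p (⟨(q.1 : ℕ), h⟩, q.2) + v p.1 * A (⟨k - 1 - (q.1 : ℕ), by omega⟩) p.2 q.2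
    else v p.1 * A 0 p.2 q.2

/-- `X = [wᵀ ⊗ A_k ; -Ŵ]`. -/
def L2X {k m n : ℕ} (A : Fin (k + 1) → Matrix (Fin m) (Fin n) F) (w : Fin k → F)
    (W : Matrix (Fin (k - 1) × Fin m) (Fin k × Fin n) F) :
    Matrix (Fin k × Fin m) (Fin k × Fin n) F :=
  Matrix.of fun p q =>
    if h : (p.1 : ℕ) = 0 then w q.1 * A (Fin.last k) p.2 q.2
    else -W (⟨(p.1 : ℕ) - 1, by have := p.1.isLt; omega⟩, p.2) q

/-- `Y = [Ŵ + wᵀ ⊗ [A_{k-1}ᵀ ⋯ A_1ᵀ]ᵀ ; wᵀ ⊗ A_0]`. -/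
def L2Y {k m n : ℕ} (A : Fin (k + 1) → Matrix (Fin m) (Fin n) F) (w : Fin k → F)
    (W : Matrix (Fin (k - 1) × Fin m) (Fin k × Fin n) F) :
    Matrix (Fin k × Fin m) (Fin k × Fin n) F :=
  Matrix.of fun p q =>
    if h : (p.1 : ℕ) < k - 1 then
      W (⟨(p.1 : ℕ), h⟩, p.2) q + w q.1 * A (⟨k - 1 - (p.1 : ℕ), by omega⟩) p.2 q.2
    else w q.1 * A 0 p.2 q.2

/-! ### block structure and `Z`-matrices -/

/-- Assemble a `km × kn` matrix from blocks with row split `m + (k-1)m` and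
column split `n + (k-1)n`. -/
def blk {k m n : ℕ} (TL : Matrix (Fin m) (Fin n) F)
    (TR : Matrix (Fin m) (Fin (k - 1) × Fin n) F)
    (BL : Matrix (Fin (k - 1) × Fin m) (Fin n) F)
    (BR : Matrix (Fin (k - 1) × Fin m) (Fin (k - 1) × Fin n) F) :
    Matrix (Fin k × Fin m) (Fin k × Fin n) F :=
  Matrix.of fun p q =>
    if hp : (p.1 : ℕ) = 0 then
      if hq : (q.1 : ℕ) = 0 then TL p.2 q.2
      else TR p.2 (⟨(q.1 : ℕ) - 1, by have := q.1.isLt; omega⟩, q.2)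
    else
      if hq : (q.1 : ℕ) = 0 then
        BL (⟨(p.1 : ℕ) - 1, by have := p.1.isLt; omega⟩, p.2) q.2
      else
        BR (⟨(p.1 : ℕ) - 1, by have := p.1.isLt; omega⟩, p.2)
          (⟨(q.1 : ℕ) - 1, by have := q.1.isLt; omega⟩, q.2)

/-- Assemble `[[Y₁₁, T],[Z, 0]]`, row split `m + (k-1)m`, column split `(k-1)n + n`. -/
def blkY1 {k m n : ℕ} (Y11 : Matrix (Fin m) (Fin (k - 1) × Fin n) F)
    (T : Matrix (Fin m) (Fin n) F)
    (Z : Matrix (Fin (k - 1) × Fin m) (Fin (k - 1) × Fin n) F) :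
    Matrix (Fin k × Fin m) (Fin k × Fin n) F :=
  Matrix.of fun p q =>
    if hp : (p.1 : ℕ) = 0 then
      if hq : (q.1 : ℕ) < k - 1 then Y11 p.2 (⟨(q.1 : ℕ), hq⟩, q.2) else T p.2 q.2
    else
      if hq : (q.1 : ℕ) < k - 1 then
        Z (⟨(p.1 : ℕ) - 1, by have := p.1.isLt; omega⟩, p.2) (⟨(q.1 : ℕ), hq⟩, q.2)
      else 0

/-- Assemble `[[Y₁₁, Z],[T, 0]]`, row split `(k-1)m + m`, column split `n + (k-1)n`. -/
def blkY2 {k m n : ℕ} (Y11 : Matrix (Fin (k - 1) × Fin m) (Fin n) F)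
    (Z : Matrix (Fin (k - 1) × Fin m) (Fin (k - 1) × Fin n) F)
    (T : Matrix (Fin m) (Fin n) F) :
    Matrix (Fin k × Fin m) (Fin k × Fin n) F :=
  Matrix.of fun p q =>
    if hp : (p.1 : ℕ) < k - 1 then
      if hq : (q.1 : ℕ) = 0 then Y11 (⟨(p.1 : ℕ), hp⟩, p.2) q.2
      else Z (⟨(p.1 : ℕ), hp⟩, p.2) (⟨(q.1 : ℕ) - 1, by have := q.1.isLt; omega⟩, q.2)
    else
      if hq : (q.1 : ℕ) = 0 then T p.2 q.2 else 0

/-- The `Z`-matrix of `L = λX + Y ∈ 𝕃₁(P)` with respect to `M`: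
the lower-left `(k-1)m × (k-1)n` block of `(M ⊗ I_m) Y`. -/
def Zmat1 {k m n : ℕ} (M : Matrix (Fin k) (Fin k) F)
    (Yc : Matrix (Fin k × Fin m) (Fin k × Fin n) F) :
    Matrix (Fin (k - 1) × Fin m) (Fin (k - 1) × Fin n) F :=
  Matrix.of fun p q =>
    (kronId M * Yc : Matrix (Fin k × Fin m) (Fin k × Fin n) F)
      (⟨(p.1 : ℕ) + 1, by have := p.1.isLt; omega⟩, p.2)
      (⟨(q.1 : ℕ), by have := q.1.isLt; omega⟩, q.2)

/-- The `Z`-matrix of `L = λX + Y ∈ 𝕃₂(P)` with respect to `M̂`: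
the upper-right `(k-1)m × (k-1)n` block of `Y (M̂ᵀ ⊗ I_n)`. -/
def Zmat2 {k m n : ℕ} (M : Matrix (Fin k) (Fin k) F)
    (Yc : Matrix (Fin k × Fin m) (Fin k × Fin n) F) :
    Matrix (Fin (k - 1) × Fin m) (Fin (k - 1) × Fin n) F :=
  Matrix.of fun p q =>
    (Yc * kronId Mᵀ : Matrix (Fin k × Fin m) (Fin k × Fin n) F)
      (⟨(p.1 : ℕ), by have := p.1.isLt; omega⟩, p.2)
      (⟨(q.1 : ℕ) + 1, by have := q.1.isLt; omega⟩, q.2)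

/-- `L = λX + Y ∈ 𝕃₁(P)` with right ansatz vector `v` has full `Z`-rank. -/
def FullZrank1 {k m n : ℕ} (Yc : Matrix (Fin k × Fin m) (Fin k × Fin n) F)
    (v : Fin k → F) : Prop :=
  ∃ (M : Matrix (Fin k) (Fin k) F) (α : F),
    IsUnit M ∧ α ≠ 0 ∧ M.mulVec v = e1 α ∧ (Zmat1 M Yc).rank = (k - 1) * n

/-- `L = λX + Y ∈ 𝕃₂(P)` with left ansatz vector `w` has full `Z`-rank. -/
def FullZrank2 {k m n : ℕ} (Yc : Matrix (Fin k × Fin m) (Fin k × Fin n) F)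
    (w : Fin k → F) : Prop :=
  ∃ (M : Matrix (Fin k) (Fin k) F) (α : F),
    IsUnit M ∧ α ≠ 0 ∧ M.mulVec w = e1 α ∧ (Zmat2 M Yc).rank = (k - 1) * m

/-! ### null spaces, minimal bases and minimal indices over `F(λ)` -/

/-- A matrix polynomial viewed as a matrix over the field of rational functions. -/
def matRF {ρ γ : Type*} (P : Matrix ρ γ F[X]) : Matrix ρ γ (RatFunc F) :=
  P.map (algebraMap F[X] (RatFunc F))

/-- The right null space `N_r(P) = {x(λ) : P(λ) x(λ) ≡ 0}` over `F(λ)`. -/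
def Nr {ρ γ : Type*} [Fintype γ] (P : Matrix ρ γ F[X]) :
    Submodule (RatFunc F) (γ → RatFunc F) :=
  LinearMap.ker (Matrix.mulVecLin (matRF P))

/-- The left null space `N_l(P) = {y(λ) : y(λ)ᵀ P(λ) ≡ 0}` over `F(λ)`. -/
def Nl {ρ γ : Type*} [Fintype ρ] (P : Matrix ρ γ F[X]) :
    Submodule (RatFunc F) (ρ → RatFunc F) :=
  Nr Pᵀ

/-- The normal rank of a matrix polynomial: its rank over `F(λ)`. -/
def nrank {ρ γ : Type*} [Fintype γ] (P : Matrix ρ γ F[X]) : ℕ :=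
  (matRF P).rank

/-- The rational vector determined by a vector polynomial. -/
def polyVec {γ : Type*} (x : γ → F[X]) : γ → RatFunc F :=
  fun i => algebraMap F[X] (RatFunc F) (x i)

/-- A rational vector is a vector polynomial if all its entries are polynomials. -/
def IsVecPoly {γ : Type*} (x : γ → RatFunc F) : Prop :=
  ∃ p : γ → F[X], x = polyVec p

/-- The degree of a vector polynomial: the greatest degree of its components. -/
def polyVecDeg {γ : Type*} [Fintype γ] (x : γ → F[X]) : ℕ :=
  Finset.univ.sup fun i => (x i).natDegree

/-- A polynomial basis of the subspace `V` of `F(λ)^γ`. -/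
def IsPolyBasis {γ ι : Type*} [Fintype γ]
    (V : Submodule (RatFunc F) (γ → RatFunc F)) (b : ι → γ → F[X]) : Prop :=
  LinearIndependent (RatFunc F) (fun i => polyVec (b i)) ∧
    Submodule.span (RatFunc F) (Set.range fun i => polyVec (b i)) = V

/-- A minimal basis of `V`: a polynomial basis of least order (sum of degrees). -/
def IsMinimalBasis {γ ι : Type*} [Fintype γ] [Fintype ι]
    (V : Submodule (RatFunc F) (γ → RatFunc F)) (b : ι → γ → F[X]) : Prop :=
  IsPolyBasis V b ∧
    ∀ (d : ℕ) (b' : Fin d → γ → F[X]), IsPolyBasis V b' →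
      ∑ i, polyVecDeg (b i) ≤ ∑ i, polyVecDeg (b' i)

/-- `ε` is the list of minimal indices of `V`: some minimal basis of `V` has
`ε` as its list of degrees. -/
def HasMinIndices {γ : Type*} [Fintype γ]
    (V : Submodule (RatFunc F) (γ → RatFunc F)) {d : ℕ} (ε : Fin d → ℕ) : Prop :=
  ∃ b : Fin d → γ → F[X], IsMinimalBasis V b ∧ ∀ i, polyVecDeg (b i) = ε i

/-- `Λ_k(λ) ⊗ x(λ)`. -/
def lamTensor {n : ℕ} (k : ℕ) (x : Fin n → RatFunc F) : Fin k × Fin n → RatFunc F :=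
  fun p => algebraMap F[X] (RatFunc F) (Polynomial.X ^ (k - 1 - (p.1 : ℕ))) * x p.2

/-- The matrix `vᵀ ⊗ I_m` over `F(λ)`; `𝓛_v(y) = (vproj v).mulVec y`. -/
def vproj {k m : ℕ} (v : Fin k → F) : Matrix (Fin m) (Fin k × Fin m) (RatFunc F) :=
  Matrix.of fun r p =>
    if r = p.2 then algebraMap F[X] (RatFunc F) (Polynomial.C (v p.1)) else 0

/-- `(vᵀ ⊗ I_m) y` at the level of vector polynomials. -/
def LvPoly {k m : ℕ} (v : Fin k → F) (y : Fin k × Fin m → F[X]) : Fin m → F[X] :=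
  fun r => ∑ i : Fin k, Polynomial.C (v i) * y (i, r)

/-- The rational subspace spanned by the rows of a matrix polynomial. -/
def rowSpan {ρ γ : Type*} [Fintype γ] (B : Matrix ρ γ F[X]) :
    Submodule (RatFunc F) (γ → RatFunc F) :=
  Submodule.span (RatFunc F) (Set.range fun i => polyVec (B i))

/-- A matrix polynomial is a minimal basis if its rows form a minimal basis of the
rational subspace they span. -/
def IsMinimalBasisMat {ρ γ : Type*} [Fintype ρ] [Fintype γ] (B : Matrix ρ γ F[X]) : Prop :=
  IsMinimalBasis (rowSpan B) (fun i => B i)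

/-- Dual minimal bases: `B ∈ F[λ]^{n₁×n}`, `C ∈ F[λ]^{n₂×n}` minimal bases with
`n₁ + n₂ = n` and `B Cᵀ = 0`. -/
def DualMinBases {ρ ρ' γ : Type*} [Fintype ρ] [Fintype ρ'] [Fintype γ]
    (B : Matrix ρ γ F[X]) (Cm : Matrix ρ' γ F[X]) : Prop :=
  IsMinimalBasisMat B ∧ IsMinimalBasisMat Cm ∧
    Fintype.card ρ + Fintype.card ρ' = Fintype.card γ ∧ B * Cmᵀ = 0

/-! ### norms, singular values -/

/-- Square of the Frobenius norm of a constant matrix. -/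
def frobSq {ρ γ : Type*} [Fintype ρ] [Fintype γ] (Ac : Matrix ρ γ F) : ℝ :=
  ∑ i, ∑ j, ‖Ac i j‖ ^ 2

/-- `‖λX + Y‖_F = sqrt(‖X‖_F² + ‖Y‖_F²)`. -/
def penFrob {ρ γ : Type*} [Fintype ρ] [Fintype γ] (Xc Yc : Matrix ρ γ F) : ℝ :=
  Real.sqrt (frobSq Xc + frobSq Yc)

/-- `‖P‖_F = sqrt(∑ ‖A_i‖_F²)` for `P(λ) = ∑ λ^i A_i`. -/
def famFrob {k m n : ℕ} (A : Fin (k + 1) → Matrix (Fin m) (Fin n) F) : ℝ :=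
  Real.sqrt (∑ i, frobSq (A i))

/-- `‖P‖_F` for a matrix polynomial of grade `g`. -/
def mpolyFrob {ρ γ : Type*} [Fintype ρ] [Fintype γ] (g : ℕ) (P : Matrix ρ γ F[X]) : ℝ :=
  Real.sqrt (∑ i, ∑ j, ∑ d ∈ Finset.range (g + 1), ‖(P i j).coeff d‖ ^ 2)

/-- Square of the Euclidean norm of a vector. -/
def vecNormSq {ι : Type*} [Fintype ι] (x : ι → F) : ℝ := ∑ i, ‖x i‖ ^ 2

/-- The smallest singular value of a matrix. -/
def sigmaMin {ρ γ : Type*} [Fintype ρ] [Fintype γ] (Ac : Matrix ρ γ F) : ℝ :=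
  if Fintype.card γ ≤ Fintype.card ρ then
    sInf {r : ℝ | ∃ x : γ → F, vecNormSq x = 1 ∧ r = Real.sqrt (vecNormSq (Ac.mulVec x))}
  else
    sInf {r : ℝ | ∃ y : ρ → F, vecNormSq y = 1 ∧ r = Real.sqrt (vecNormSq (Acᴴ.mulVec y))}

/-- The spectral norm (2-norm) of a matrix. -/
def norm2 {ρ γ : Type*} [Fintype ρ] [Fintype γ] (Ac : Matrix ρ γ F) : ℝ :=
  sSup {r : ℝ | ∃ x : γ → F, vecNormSq x = 1 ∧ r = Real.sqrt (vecNormSq (Ac.mulVec x))}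

/-- `κ₂(D) = ‖D‖₂ ‖D⁻¹‖₂`. -/
def cond2 {ρ : Type*} [Fintype ρ] [DecidableEq ρ] (Dc : Matrix ρ ρ F) : ℝ :=
  norm2 Dc * norm2 Dc⁻¹

/-! ### pencils used in the backward error analysis -/

/-- `B(λ) = λ [0 ∣ -R̃] + [R̃ ∣ 0]`, i.e. `R̃ (H_{k-1}(λ) ⊗ I_n)` up to sign conventions. -/
def Bpencil {k n : ℕ} (R : Matrix (Fin (k - 1) × Fin n) (Fin (k - 1) × Fin n) F) :
    Matrix (Fin (k - 1) × Fin n) (Fin k × Fin n) F[X] :=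
  Matrix.of fun p q =>
    (if h : (q.1 : ℕ) < k - 1 then Polynomial.C (R p (⟨(q.1 : ℕ), h⟩, q.2)) else 0) +
    (if h : 0 < (q.1 : ℕ) then
        Polynomial.X *
          Polynomial.C (-R p (⟨(q.1 : ℕ) - 1, by have := q.1.isLt; omega⟩, q.2))
      else 0)

/-- The coefficient of `λ` in `H_{k-1}(λ) ⊗ I_n`. -/
def Hlam (F : Type*) [RCLike F] (k n : ℕ) :
    Matrix (Fin (k - 1) × Fin n) (Fin k × Fin n) F :=
  Matrix.of fun p q => if p.2 = q.2 ∧ (q.1 : ℕ) = (p.1 : ℕ) + 1 then 1 else 0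

/-- The constant coefficient of `H_{k-1}(λ) ⊗ I_n`. -/
def Hconst (F : Type*) [RCLike F] (k n : ℕ) :
    Matrix (Fin (k - 1) × Fin n) (Fin k × Fin n) F :=
  Matrix.of fun p q => if p.2 = q.2 ∧ (q.1 : ℕ) = (p.1 : ℕ) then -1 else 0

/-- The convolution matrix `C_j(λ Xc + Yc)` of a pencil, with `j+1` block columns. -/
def convPencil {ρ γ : Type*} (Xc Yc : Matrix ρ γ F) (j : ℕ) :
    Matrix (Fin (j + 2) × ρ) (Fin (j + 1) × γ) F :=
  Matrix.of fun r c =>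
    if (r.1 : ℕ) = (c.1 : ℕ) then Xc r.2 c.2
    else if (r.1 : ℕ) = (c.1 : ℕ) + 1 then Yc r.2 c.2 else 0

/-- λ-coefficient of the trimmed pencil `L̂_t(λ)`:
`[[α A_k, X₁₂],[0, -R̃]]` with row split `m + (k-1)n`. -/
def LtX {k m n : ℕ} (α : F) (Ak : Matrix (Fin m) (Fin n) F)
    (X12 : Matrix (Fin m) (Fin (k - 1) × Fin n) F)
    (R : Matrix (Fin (k - 1) × Fin n) (Fin (k - 1) × Fin n) F) :
    Matrix (Fin m ⊕ (Fin (k - 1) × Fin n)) (Fin k × Fin n) F :=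
  Matrix.of fun s q =>
    Sum.elim
      (fun r => if h : (q.1 : ℕ) = 0 then α * Ak r q.2
        else X12 r (⟨(q.1 : ℕ) - 1, by have := q.1.isLt; omega⟩, q.2))
      (fun p => if h : (q.1 : ℕ) = 0 then 0
        else -R p (⟨(q.1 : ℕ) - 1, by have := q.1.isLt; omega⟩, q.2)) s

/-- Constant coefficient of the trimmed pencil `L̂_t(λ)`:
`[[Y₁₁, α A₀],[R̃, 0]]` with row split `m + (k-1)n`. -/
def LtY {k m n : ℕ} (α : F) (A0 : Matrix (Fin m) (Fin n) F)
    (Y11 : Matrix (Fin m) (Fin (k - 1) × Fin n) F)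
    (R : Matrix (Fin (k - 1) × Fin n) (Fin (k - 1) × Fin n) F) :
    Matrix (Fin m ⊕ (Fin (k - 1) × Fin n)) (Fin k × Fin n) F :=
  Matrix.of fun s q =>
    Sum.elim
      (fun r => if h : (q.1 : ℕ) < k - 1 then Y11 r (⟨(q.1 : ℕ), h⟩, q.2)
        else α * A0 r q.2)
      (fun p => if h : (q.1 : ℕ) < k - 1 then R p (⟨(q.1 : ℕ), h⟩, q.2) else 0) s

/-! ### trimming -/

/-- The rows `[0 ∣ Q₂*] (M ⊗ I_m)`. -/
def bottomRows {k m n c : ℕ} (M : Matrix (Fin k) (Fin k) F)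
    (Q : Matrix (Fin (k - 1) × Fin m) ((Fin (k - 1) × Fin n) ⊕ Fin c) F) :
    Matrix (Fin c) (Fin k × Fin m) F :=
  (Matrix.of fun (j : Fin c) (p : Fin k × Fin m) =>
      if h : (p.1 : ℕ) = 0 then 0
      else star (Q (⟨(p.1 : ℕ) - 1, by have := p.1.isLt; omega⟩, p.2) (Sum.inr j)))
    * kronId M

/-- The square matrix `[D ; [0 ∣ Q₂*](M ⊗ I_m)]` whose invertibility makes `D` admissible. -/
def trimAux {k m n c : ℕ} (M : Matrix (Fin k) (Fin k) F)
    (Q : Matrix (Fin (k - 1) × Fin m) ((Fin (k - 1) × Fin n) ⊕ Fin c) F)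
    (D : Matrix (Fin m ⊕ (Fin (k - 1) × Fin n)) (Fin k × Fin m) F) :
    Matrix ((Fin m ⊕ (Fin (k - 1) × Fin n)) ⊕ Fin c) (Fin k × Fin m) F :=
  Matrix.of (Sum.elim (fun i j => D i j) (fun i j => bottomRows M Q i j))

/-- The columns `(M̂ᵀ ⊗ I_n) [0 ; Q₂]`. -/
def rightCols {k m n c : ℕ} (M : Matrix (Fin k) (Fin k) F)
    (Q : Matrix (Fin (k - 1) × Fin n) ((Fin (k - 1) × Fin m) ⊕ Fin c) F) :
    Matrix (Fin k × Fin n) (Fin c) F :=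
  kronId Mᵀ *
    (Matrix.of fun (q : Fin k × Fin n) (j : Fin c) =>
      if h : (q.1 : ℕ) = 0 then 0
      else Q (⟨(q.1 : ℕ) - 1, by have := q.1.isLt; omega⟩, q.2) (Sum.inr j))

/-- The square matrix `[D̂ ∣ (M̂ᵀ ⊗ I_n)[0 ; Q₂]]` whose invertibility makes `D̂` admissible. -/
def trimAux2 {k m n c : ℕ} (M : Matrix (Fin k) (Fin k) F)
    (Q : Matrix (Fin (k - 1) × Fin n) ((Fin (k - 1) × Fin m) ⊕ Fin c) F)
    (D : Matrix (Fin k × Fin n) (Fin n ⊕ (Fin (k - 1) × Fin m)) F) :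
    Matrix (Fin k × Fin n) ((Fin n ⊕ (Fin (k - 1) × Fin m)) ⊕ Fin c) F :=
  Matrix.of fun q s => Sum.elim (fun t => D q t) (fun j => rightCols M Q q j) s

/-! ### full row rank and surjective linear maps -/

/-- Two surjective linear maps between the same finite-dimensional spaces differ by an
automorphism of the source. -/
lemma exists_linearEquiv_comp_eq {K V W : Type*} [Field K] [AddCommGroup V] [Module K V]
    [AddCommGroup W] [Module K W] [FiniteDimensional K V] (f g : V →ₗ[K] W)
    (hf : Function.Surjective f) (hg : Function.Surjective g) :
    ∃ e : V ≃ₗ[K] V, f ∘ₗ e.toLinearMap = g := by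
  obtain ⟨s, hs⟩ := f.exists_rightInverse_of_surjective (LinearMap.range_eq_top.2 hf)
  obtain ⟨t, ht⟩ := g.exists_rightInverse_of_surjective (LinearMap.range_eq_top.2 hg)
  have hs' : ∀ x, f (s x) = x := fun x => LinearMap.congr_fun hs x
  have ht' : ∀ x, g (t x) = x := fun x => LinearMap.congr_fun ht x
  have hdim : Module.finrank K (LinearMap.ker g) = Module.finrank K (LinearMap.ker f) := by
    have h1 := f.finrank_range_add_finrank_ker
    have h2 := g.finrank_range_add_finrank_ker
    rw [LinearMap.range_eq_top.2 hf] at h1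
    rw [LinearMap.range_eq_top.2 hg] at h2
    omega
  let κ := LinearEquiv.ofFinrankEq _ _ hdim
  let pr : V →ₗ[K] LinearMap.ker g :=
    (LinearMap.id - t ∘ₗ g).codRestrict _ (fun v => by simp [ht'])
  let φ : V →ₗ[K] V := s ∘ₗ g + (LinearMap.ker f).subtype ∘ₗ κ.toLinearMap ∘ₗ pr
  have hfφ : ∀ v, f (φ v) = g v := fun v => by simp [φ, hs']
  have hinj : Function.Injective φ := by
    rw [← LinearMap.ker_eq_bot, LinearMap.ker_eq_bot']
    intro v hv
    have hgv : g v = 0 := by rw [← hfφ, hv, map_zero]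
    have hpr : pr v = 0 := by simpa [φ, hgv] using hv
    simpa [pr, hgv] using congrArg Subtype.val hpr
  exact ⟨LinearEquiv.ofInjectiveEndo φ hinj, LinearMap.ext fun v => hfφ v⟩

/-- A matrix whose rank is its number of rows defines a surjective map. -/
lemma mulVecLin_surjective_of_rank {K ρ γ : Type*} [Field K] [Fintype ρ] [Fintype γ]
    (Z : Matrix ρ γ K) (h : Z.rank = Fintype.card ρ) : Function.Surjective Z.mulVecLin := by
  rw [← LinearMap.range_eq_top]
  apply Submodule.eq_top_of_finrank_eq
  rw [Module.finrank_fintype_fun_eq_card, ← h]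
  rfl

/-- Two matrices of full row rank differ by an invertible column transformation. -/
lemma exists_mul_eq_of_full_row_rank {K ρ γ : Type*} [Field K] [Fintype ρ] [Fintype γ]
    [DecidableEq γ] (Z J : Matrix ρ γ K)
    (hZ : Z.rank = Fintype.card ρ) (hJ : Function.Surjective J.mulVecLin) :
    ∃ G : Matrix γ γ K, IsUnit G ∧ Z * G = J := by
  obtain ⟨e, he⟩ := exists_linearEquiv_comp_eq Z.mulVecLin J.mulVecLin
    (mulVecLin_surjective_of_rank Z hZ) hJ
  refine ⟨LinearMap.toMatrix' e.toLinearMap, ?_, ?_⟩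
  · rw [Matrix.isUnit_iff_isUnit_det, LinearMap.det_toMatrix']
    exact LinearEquiv.isUnit_det' e
  · have := congrArg LinearMap.toMatrix' he
    rwa [LinearMap.toMatrix'_comp, ← Matrix.toLin'_apply', ← Matrix.toLin'_apply',
      LinearMap.toMatrix'_toLin', LinearMap.toMatrix'_toLin'] at this

/-! ### Kronecker products with an identity -/

lemma kronId_eq_kronecker {k m : ℕ} (M : Matrix (Fin k) (Fin k) F) :
    (kronId M : Matrix (Fin k × Fin m) (Fin k × Fin m) F) =
      Matrix.kroneckerMap (· * ·) M (1 : Matrix (Fin m) (Fin m) F) := by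
  ext p q
  simp [kronId, Matrix.one_apply]

lemma isUnit_kronId {k m : ℕ} {M : Matrix (Fin k) (Fin k) F} (hM : IsUnit M) :
    IsUnit (kronId M : Matrix (Fin k × Fin m) (Fin k × Fin m) F) := by
  rw [Matrix.isUnit_iff_isUnit_det] at hM ⊢
  rw [kronId_eq_kronecker, Matrix.det_kronecker]
  simpa using hM.pow _

lemma sum_mul_kronId_transpose {k n : ℕ} (M : Matrix (Fin k) (Fin k) F) (w : Fin k → F)
    (a : Fin n → F) (q : Fin k × Fin n) :
    ∑ q' : Fin k × Fin n, w q'.1 * a q'.2 * (kronId Mᵀ : Matrix _ (Fin k × Fin n) F) q' q =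
      M.mulVec w q.1 * a q.2 := by
  simp [Fintype.sum_prod_type, kronId, Matrix.mulVec, dotProduct, Finset.sum_mul]
  exact Finset.sum_congr rfl fun i _ => by ring

/-- The block `I_s ⊗ I_{m,n}`. -/
def rectId (R : Type*) [Zero R] [One R] (s m n : ℕ) :
    Matrix (Fin s × Fin m) (Fin s × Fin n) R :=
  Matrix.of fun p q => if p.1 = q.1 ∧ (p.2 : ℕ) = (q.2 : ℕ) then 1 else 0

lemma rectId_mul_transpose {R : Type*} [CommRing R] {s m n : ℕ} (hmn : m ≤ n) :
    rectId R s m n * (rectId R s m n)ᵀ = 1 := by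
  ext p q
  rw [Matrix.mul_apply, Finset.sum_eq_single (p.1, Fin.castLE hmn p.2)]
  · simp [rectId, Matrix.one_apply, Prod.ext_iff, Fin.ext_iff, eq_comm]
  · intro b _ hb
    have : ¬ (p.1 = b.1 ∧ (p.2 : ℕ) = (b.2 : ℕ)) := fun h =>
      hb (Prod.ext h.1.symm (Fin.ext h.2.symm))
    simp [rectId, this]
  · simp

lemma rectId_surjective {s m n : ℕ} (hmn : m ≤ n) :
    Function.Surjective (rectId F s m n).mulVecLin := fun y =>
  ⟨(rectId F s m n)ᵀ.mulVec y, by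
    rw [Matrix.mulVecLin_apply, Matrix.mulVec_mulVec, rectId_mul_transpose hmn, Matrix.one_mulVec]⟩

/-! ### the coefficient form of the left ansatz identity -/

/-- The left ansatz identity `(Λᵀ ⊗ I) (λX + Y) = wᵀ ⊗ P(λ)` compared coefficientwise. -/
structure AnsatzCoeffs {j m n : ℕ} (A : Fin (j + 1 + 1) → Matrix (Fin m) (Fin n) F)
    (Xc Yc : Matrix (Fin (j + 1) × Fin m) (Fin (j + 1) × Fin n) F) (w : Fin (j + 1) → F) :
    Prop where
  leading : ∀ r q, Xc (0, r) q = w q.1 * A (Fin.last (j + 1)) r q.2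
  constant : ∀ r q, Yc (Fin.last j, r) q = w q.1 * A 0 r q.2
  middle : ∀ (i : Fin j) r q, Yc (i.castSucc, r) q + Xc (i.succ, r) q =
    w q.1 * A i.rev.succ.castSucc r q.2

lemma matPoly_apply_succ {j m n : ℕ} (A : Fin (j + 1 + 1) → Matrix (Fin m) (Fin n) F)
    (r : Fin m) (c : Fin n) :
    matPoly A r c = C (A (Fin.last (j + 1)) r c) * X ^ (j + 1) + C (A 0 r c) +
      ∑ i : Fin j, C (A i.rev.succ.castSucc r c) * X ^ (j - (i : ℕ)) := by
  rw [matPoly, Matrix.of_apply, Fin.sum_univ_castSucc, Fin.sum_univ_succ,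
    ← Equiv.sum_comp Fin.revPerm]
  have h : ∀ i : Fin j, j - ((i : ℕ) + 1) + 1 = j - i := fun i => by omega
  simp [h]
  ring

lemma LamRow_mul_pencil_apply {j m n : ℕ}
    (Xc Yc : Matrix (Fin (j + 1) × Fin m) (Fin (j + 1) × Fin n) F)
    (r : Fin m) (q : Fin (j + 1) × Fin n) :
    (LamRow F (j + 1) m * pencil Xc Yc) r q =
      C (Xc (0, r) q) * X ^ (j + 1) + C (Yc (Fin.last j, r) q) +
      ∑ i : Fin j, C (Yc (i.castSucc, r) q + Xc (i.succ, r) q) * X ^ (j - (i : ℕ)) := by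
  have h : ∀ i : Fin j, j - ((i : ℕ) + 1) + 1 = j - i := fun i => by omega
  have h1 : (LamRow F (j + 1) m * pencil Xc Yc) r q =
      ∑ i : Fin (j + 1), C (Xc (i, r) q) * X ^ (j - (i : ℕ) + 1) +
      ∑ i : Fin (j + 1), C (Yc (i, r) q) * X ^ (j - (i : ℕ)) := by
    simp only [Matrix.mul_apply, LamRow, pencil, Matrix.of_apply, Fintype.sum_prod_type, ite_mul,
      zero_mul, Finset.sum_ite_eq, Finset.mem_univ, if_true, ← Finset.sum_add_distrib]
    refine Finset.sum_congr rfl fun i _ => ?_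
    simp only [Nat.add_sub_cancel]
    ring
  rw [h1, Fin.sum_univ_succ, Fin.sum_univ_castSucc (n := j)]
  simp [h, add_mul, Finset.sum_add_distrib]
  ring

lemma coeff_expansion_injective {j : ℕ} {a b a' b' : F} {c c' : Fin j → F}
    (h : C a * X ^ (j + 1) + C b + ∑ i : Fin j, C (c i) * X ^ (j - (i : ℕ)) =
      C a' * X ^ (j + 1) + C b' + ∑ i : Fin j, C (c' i) * X ^ (j - (i : ℕ))) :
    a = a' ∧ b = b' ∧ c = c' := by
  have key : ∀ d, _ := fun d => congrArg (fun p => Polynomial.coeff p d) h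
  simp only [coeff_add, finsetSum_coeff, coeff_C_mul_X_pow, coeff_C] at key
  refine ⟨?_, ?_, funext fun l => ?_⟩
  · have e : ∀ i : Fin j, ¬ (j + 1 = j - (i : ℕ)) := fun i => by omega
    simpa [e] using key (j + 1)
  · have e : ∀ i : Fin j, ¬ (0 = j - (i : ℕ)) := fun i => by omega
    simpa [e] using key 0
  · have e : ∀ i : Fin j, (j - (l : ℕ) = j - (i : ℕ)) ↔ l = i := fun i => by
      rw [Fin.ext_iff]; omega
    have e_lead : ¬ (j - (l : ℕ) = j + 1) := by omega
    have e_const : ¬ (j - (l : ℕ) = 0) := by omega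
    have := key (j - l)
    simp only [e, e_lead, e_const] at this
    simpa using this

lemma leftAnsatz_iff_ansatzCoeffs {j m n : ℕ}
    {A : Fin (j + 1 + 1) → Matrix (Fin m) (Fin n) F}
    {Xc Yc : Matrix (Fin (j + 1) × Fin m) (Fin (j + 1) × Fin n) F} {w : Fin (j + 1) → F} :
    LeftAnsatz (matPoly A) (pencil Xc Yc) w ↔ AnsatzCoeffs A Xc Yc w := by
  have hr : ∀ r q, wkron w (matPoly A) r q =
      C (w q.1 * A (Fin.last (j + 1)) r q.2) * X ^ (j + 1) + C (w q.1 * A 0 r q.2) +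
      ∑ i : Fin j, C (w q.1 * A i.rev.succ.castSucc r q.2) * X ^ (j - (i : ℕ)) := fun r q => by
    rw [wkron, Matrix.of_apply, matPoly_apply_succ, mul_add, mul_add, Finset.mul_sum]
    simp only [C_mul, mul_assoc]
  constructor
  · intro h
    have hh : ∀ r q, _ := fun r q => coeff_expansion_injective
      ((LamRow_mul_pencil_apply Xc Yc r q).symm.trans
        ((congrFun (congrFun h r) q).trans (hr r q)))
    exact ⟨fun r q => (hh r q).1, fun r q => (hh r q).2.1,
      fun i r q => congrFun (hh r q).2.2 i⟩
  · intro h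
    refine Matrix.ext fun r q => ?_
    rw [LamRow_mul_pencil_apply, hr, h.leading, h.constant]
    simp only [h.middle]

lemma AnsatzCoeffs.mul_kronId {j m n : ℕ} {A : Fin (j + 1 + 1) → Matrix (Fin m) (Fin n) F}
    {Xc Yc : Matrix (Fin (j + 1) × Fin m) (Fin (j + 1) × Fin n) F} {w : Fin (j + 1) → F}
    (h : AnsatzCoeffs A Xc Yc w) (M : Matrix (Fin (j + 1)) (Fin (j + 1)) F) :
    AnsatzCoeffs A (Xc * (kronId Mᵀ : Matrix (Fin (j + 1) × Fin n) (Fin (j + 1) × Fin n) F))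
      (Yc * (kronId Mᵀ : Matrix (Fin (j + 1) × Fin n) (Fin (j + 1) × Fin n) F))
      (M.mulVec w) := by
  refine ⟨fun r q => ?_, fun r q => ?_, fun i r q => ?_⟩
  · simp only [Matrix.mul_apply, h.leading, sum_mul_kronId_transpose M w (A (Fin.last (j + 1)) r)]
  · simp only [Matrix.mul_apply, h.constant, sum_mul_kronId_transpose M w (A 0 r)]
  · simp only [Matrix.mul_apply, ← Finset.sum_add_distrib, ← add_mul, h.middle,
      sum_mul_kronId_transpose M w (A i.rev.succ.castSucc r)]

/-- Reversing the pencil and its block rows reverses the coefficients in the ansatz. -/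
lemma AnsatzCoeffs.reverse {j m n : ℕ} {A : Fin (j + 1 + 1) → Matrix (Fin m) (Fin n) F}
    {Xc Yc : Matrix (Fin (j + 1) × Fin m) (Fin (j + 1) × Fin n) F} {w : Fin (j + 1) → F}
    (h : AnsatzCoeffs A Xc Yc w) :
    AnsatzCoeffs (A ∘ Fin.rev) (Yc.submatrix (Prod.map Fin.rev id) id)
      (Xc.submatrix (Prod.map Fin.rev id) id) w := by
  refine ⟨fun r q => ?_, fun r q => ?_, fun i r q => ?_⟩
  · simpa using h.constant r q
  · simpa using h.leading r q
  · have := h.middle i.rev r q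
    simp [Fin.rev_castSucc, Fin.rev_succ] at this ⊢
    rw [add_comm, this]

/-! ### unimodular equivalence -/

lemma IsGLin.of_mul_right {k m n : ℕ} {P : Matrix (Fin m) (Fin n) F[X]}
    {L : Matrix (Fin k × Fin m) (Fin k × Fin n) F[X]}
    {K : Matrix (Fin k × Fin n) (Fin k × Fin n) F[X]} (hK : IsUnit K.det)
    (h : IsGLin P (L * K)) : IsGLin P L := by
  obtain ⟨E, G, hE, hG, hEG⟩ := h
  refine ⟨E, K * G, hE, ?_, ?_⟩
  · rw [Matrix.det_mul]
    exact hK.mul hG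
  · simpa only [Matrix.mul_assoc] using hEG

lemma IsGLin.of_submatrix_rows {k m n : ℕ} {P : Matrix (Fin m) (Fin n) F[X]}
    {L : Matrix (Fin k × Fin m) (Fin k × Fin n) F[X]} (e : Fin k × Fin m ≃ Fin k × Fin m)
    (h : IsGLin P (L.submatrix e id)) : IsGLin P L := by
  obtain ⟨E, G, hE, hG, hEG⟩ := h
  refine ⟨E.submatrix id e.symm, G, ?_, hG, ?_⟩
  · rw [← Matrix.isUnit_iff_isUnit_det] at hE ⊢
    exact (Matrix.isUnit_submatrix_equiv (Equiv.refl _) e.symm).2 hE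
  · rw [← hEG]
    congr 1
    have := Matrix.submatrix_mul_equiv E (L.submatrix e id) id e.symm id
    rwa [Matrix.submatrix_submatrix, Equiv.self_comp_symm, Function.id_comp,
      Matrix.submatrix_id_id, Matrix.submatrix_id_id] at this

/-- Separate the block with index `a` from the other blocks. -/
def splitBlock {j : ℕ} (m : ℕ) (a : Fin (j + 1)) :
    Fin m ⊕ (Fin j × Fin m) ≃ Fin (j + 1) × Fin m :=
  Equiv.ofBijective
    (Sum.elim (fun r => (a, r)) (fun p => (a.succAbove p.1, p.2))) <| by
      constructor
      · rintro (r | p) (r' | p') h <;> simp_all [Prod.ext_iff, Fin.ne_succAbove, Fin.succAbove_ne]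
      · rintro ⟨i, r⟩
        by_cases hi : i = a
        · exact ⟨Sum.inl r, by simp [hi]⟩
        · obtain ⟨l, rfl⟩ := Fin.exists_succAbove_eq hi
          exact ⟨Sum.inr (l, r), rfl⟩

@[simp] lemma splitBlock_inl {j m : ℕ} (a : Fin (j + 1)) (r : Fin m) :
    splitBlock m a (Sum.inl r) = (a, r) := rfl

@[simp] lemma splitBlock_inr {j m : ℕ} (a : Fin (j + 1)) (p : Fin j × Fin m) :
    splitBlock m a (Sum.inr p) = (a.succAbove p.1, p.2) := rfl

lemma glinTarget_submatrix {j m n : ℕ} (P : Matrix (Fin m) (Fin n) F[X]) :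
    (glinTarget P).submatrix (splitBlock m 0) (splitBlock n 0) =
      Matrix.fromBlocks P 0 0 (rectId F[X] j m n) := by
  ext (r | p) (c | q)
  · simp [glinTarget]
  · simp [glinTarget, eq_comm, Fin.succ_ne_zero]
  · simp [glinTarget]
  · simp [glinTarget, rectId, ite_and]

lemma isGLin_of_blocks {j m n : ℕ} {P : Matrix (Fin m) (Fin n) F[X]}
    {L : Matrix (Fin (j + 1) × Fin m) (Fin (j + 1) × Fin n) F[X]}
    (a : Fin (j + 1))
    {E : Matrix (Fin m ⊕ (Fin j × Fin m)) (Fin m ⊕ (Fin j × Fin m)) F[X]}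
    {G : Matrix (Fin n ⊕ (Fin j × Fin n)) (Fin n ⊕ (Fin j × Fin n)) F[X]}
    (hE : IsUnit E.det) (hG : IsUnit G.det)
    (h : E * L.submatrix (splitBlock m a) (splitBlock n 0) * G =
      Matrix.fromBlocks P 0 0 (rectId F[X] j m n)) : IsGLin P L := by
  refine ⟨E.submatrix (splitBlock m 0).symm (splitBlock m a).symm,
    G.submatrix (splitBlock n 0).symm (splitBlock n 0).symm, ?_, ?_, ?_⟩
  · rw [← Matrix.isUnit_iff_isUnit_det] at hE ⊢
    exact (Matrix.isUnit_submatrix_equiv _ _).2 hE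
  · rwa [Matrix.det_submatrix_equiv_self]
  · rw [← glinTarget_submatrix] at h
    have h' := congrArg
      (fun B => B.submatrix (splitBlock m 0).symm (splitBlock n 0).symm) h
    simp only [Matrix.submatrix_submatrix, Equiv.self_comp_symm, Matrix.submatrix_id_id] at h'
    rw [← h', ← Matrix.submatrix_mul_equiv _ _ _ (splitBlock n 0).symm,
      ← Matrix.submatrix_mul_equiv _ _ _ (splitBlock m a).symm]
    simp [Matrix.submatrix_submatrix]

/-- Reduction of a block triangular matrix with a full row rank lower right block. -/
lemma exists_unimodular_reduction {R ρ ρ' γ γ' : Type*} [CommRing R]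
    [Fintype ρ] [DecidableEq ρ] [Fintype ρ'] [DecidableEq ρ'] [Fintype γ] [DecidableEq γ]
    [Fintype γ'] [DecidableEq γ'] (P : Matrix ρ γ R) (a b : R) (hab : a * b = 1)
    (B : Matrix ρ' γ R) (T : Matrix ρ' ρ' R) (hT : IsUnit T.det)
    (Z J : Matrix ρ' γ' R) (J' : Matrix γ' ρ' R) (hJ : J * J' = 1)
    (H : Matrix γ' γ' R) (hH : IsUnit H.det) (hZ : Z * H = J) :
    ∃ (E : Matrix (ρ ⊕ ρ') (ρ ⊕ ρ') R) (G : Matrix (γ ⊕ γ') (γ ⊕ γ') R),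
      IsUnit E.det ∧ IsUnit G.det ∧
      E * Matrix.fromBlocks (a • P) 0 B (T * Z) * G = Matrix.fromBlocks P 0 0 J := by
  refine ⟨Matrix.fromBlocks (b • 1) 0 0 T⁻¹,
    Matrix.fromBlocks 1 0 (-(H * J' * (T⁻¹ * B))) H, ?_, ?_, ?_⟩
  · rw [Matrix.det_fromBlocks_zero₂₁, Matrix.det_smul, Matrix.det_one, mul_one]
    refine IsUnit.mul (IsUnit.pow _ (IsUnit.of_mul_eq_one a (by rw [mul_comm, hab]))) ?_
    exact Matrix.isUnit_nonsing_inv_det _ hT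
  · rw [Matrix.det_fromBlocks_zero₁₂, Matrix.det_one, one_mul]
    exact hH
  · have h1 : T⁻¹ * (T * Z) = Z := Matrix.nonsing_inv_mul_cancel_left _ _ hT
    simp only [Matrix.fromBlocks_multiply]
    congr 1
    · simp [smul_smul, hab]
    · simp
    · simp only [h1, Matrix.zero_mul, zero_add, Matrix.mul_one, Matrix.mul_neg,
        ← Matrix.mul_assoc, hZ, hJ, Matrix.one_mul, add_neg_cancel]
    · simp [h1, hZ]

/-! ### the linearization property -/

/-- The lower bidiagonal matrix with unit diagonal and subdiagonal entries `-λ`. -/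
def bidiag (F : Type*) [RCLike F] (j : ℕ) : Matrix (Fin j) (Fin j) F[X] :=
  Matrix.of fun i l => if i = l then 1 else if (i : ℕ) = (l : ℕ) + 1 then -X else 0

lemma det_bidiag (j : ℕ) : (bidiag F j).det = 1 := by
  rw [Matrix.det_of_isLowerTriangular]
  · simp [bidiag]
  · intro i l hil
    have h1 : i < l := hil
    have h2 : i ≠ l := h1.ne
    have h3 : ¬ ((i : ℕ) = (l : ℕ) + 1) := by omega
    simp [bidiag, h2, h3]

lemma bidiag_kronecker_mul_apply {j m : ℕ} {γ : Type*} (Z : Matrix (Fin j × Fin m) γ F[X])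
    (i : Fin j) (r : Fin m) (c : γ) :
    (Matrix.kroneckerMap (· * ·) (bidiag F j) (1 : Matrix (Fin m) (Fin m) F[X]) * Z) (i, r) c =
      Z (i, r) c - X * (if h : 0 < (i : ℕ) then Z (⟨(i : ℕ) - 1, by omega⟩, r) c else 0) := by
  simp only [Matrix.mul_apply, Matrix.kroneckerMap_apply, Fintype.sum_prod_type, Matrix.one_apply,
    mul_ite, mul_one, mul_zero, ite_mul, zero_mul, Finset.sum_ite_eq, Finset.mem_univ, if_true]
  have hb : ∀ l, bidiag F j i l * Z (l, r) c = (if i = l then Z (l, r) c else 0) -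
      (if (i : ℕ) = (l : ℕ) + 1 then X * Z (l, r) c else 0) := by
    intro l
    simp only [bidiag, Matrix.of_apply]
    split_ifs with h1 h2
    · subst h1; omega
    all_goals simp
  simp only [hb, Finset.sum_sub_distrib, Finset.sum_ite_eq, Finset.mem_univ, if_true]
  congr 1
  split_ifs with h
  · rw [Finset.sum_eq_single ⟨(i : ℕ) - 1, by omega⟩]
    · rw [if_pos]; simp; omega
    · intro b _ hb
      rw [if_neg]
      intro hh
      exact hb (Fin.ext (by simp; omega))
    · simp
  · rw [mul_zero]
    exact Finset.sum_eq_zero fun l _ => if_neg (by omega)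

/-- A pencil satisfying the ansatz with `w = α e₁` is a g-linearization when its `Z`-block has
full row rank. -/
lemma AnsatzCoeffs.isGLin_of_e1 {j m n : ℕ} (hmn : m ≤ n)
    {A : Fin (j + 1 + 1) → Matrix (Fin m) (Fin n) F}
    {Xc Yc : Matrix (Fin (j + 1) × Fin m) (Fin (j + 1) × Fin n) F} {α : F} (hα : α ≠ 0)
    (h : AnsatzCoeffs A Xc Yc (e1 α)) (Z : Matrix (Fin j × Fin m) (Fin j × Fin n) F)
    (hYZ : ∀ i r l c, Yc (Fin.castSucc i, r) (Fin.succ l, c) = Z (i, r) (l, c))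
    (hZ : Z.rank = j * m) : IsGLin (matPoly A) (pencil Xc Yc) := by
  obtain ⟨H, hH, hZH⟩ := exists_mul_eq_of_full_row_rank Z (rectId F j m n)
    (by simpa using hZ) (rectId_surjective hmn)
  have hmap : (rectId F j m n).map (C : F →+* F[X]) = rectId F[X] j m n := by
    ext p q : 1
    simp only [rectId, Matrix.map_apply, Matrix.of_apply]
    split_ifs <;> simp
  set T : Matrix (Fin j × Fin m) (Fin j × Fin m) F[X] :=
    Matrix.kroneckerMap (· * ·) (bidiag F j) 1 with hTdef
  have hT : IsUnit T.det := by
    rw [hTdef, Matrix.det_kronecker, det_bidiag]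
    simp
  have hXZ : ∀ (i : Fin j) r l c, Xc (i.succ, r) (Fin.succ l, c) = -Z (i, r) (l, c) := by
    intro i r l c
    have := h.middle i r (l.succ, c)
    rw [hYZ] at this
    have h0 : (e1 α : Fin (j + 1) → F) l.succ = 0 := by simp [e1]
    rw [h0, zero_mul] at this
    exact eq_neg_of_add_eq_zero_right this
  have hX0 : ∀ r (l : Fin j) c, Xc (0, r) (l.succ, c) = 0 := by
    intro r l c
    simp [h.leading, e1]
  set Lb := (pencil Xc Yc).submatrix (splitBlock m (Fin.last j)) (splitBlock n 0) with hLb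
  let U : Matrix (Fin m) (Fin j × Fin m) F[X] :=
    Matrix.of fun r p => if r = p.2 then X ^ (j - (p.1 : ℕ)) else 0
  have hans := leftAnsatz_iff_ansatzCoeffs.2 h
  have htop : ∀ r s, Lb (Sum.inl r) s + ∑ p, U r p * Lb (Sum.inr p) s =
      wkron (e1 α) (matPoly A) r (splitBlock n 0 s) := by
    intro r s
    rw [← congrFun (congrFun hans r) (splitBlock n 0 s), Matrix.mul_apply,
      ← Equiv.sum_comp (splitBlock m (Fin.last j)), Fintype.sum_sum_type]
    congr 1
    · simp [LamRow, hLb]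
    · simp [LamRow, hLb, U]
  let V : Matrix (Fin m ⊕ (Fin j × Fin m)) (Fin m ⊕ (Fin j × Fin m)) F[X] :=
    Matrix.fromBlocks 1 U 0 1
  have hU : V * Lb =
      Matrix.fromBlocks (C α • matPoly A) 0 Lb.toBlocks₂₁ (T * Z.map (C : F →+* F[X])) := by
    conv_lhs => rw [← Matrix.fromBlocks_toBlocks Lb]
    rw [show V = Matrix.fromBlocks 1 U 0 1 from rfl, Matrix.fromBlocks_multiply]
    congr 1
    · ext r c : 1
      simpa [Matrix.toBlocks₁₁, Matrix.toBlocks₂₁, Matrix.mul_apply, wkron, e1]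
        using htop r (Sum.inl c)
    · ext r q : 1
      simpa [Matrix.toBlocks₁₂, Matrix.toBlocks₂₂, Matrix.mul_apply, wkron, e1]
        using htop r (Sum.inr q)
    · simp
    · ext ⟨i, r⟩ ⟨l, c⟩ : 1
      rw [hTdef, bidiag_kronecker_mul_apply]
      simp only [Matrix.zero_mul, Matrix.one_mul, zero_add, Matrix.toBlocks₂₂, Matrix.of_apply, hLb,
        Matrix.submatrix_apply, splitBlock_inr, pencil, Fin.succAbove_last, Fin.succAbove_zero,
        hYZ, Matrix.map_apply]
      by_cases hi : 0 < (i : ℕ)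
      · have : i.castSucc = Fin.succ ⟨(i : ℕ) - 1, by omega⟩ := by
          ext; simp; omega
        rw [dif_pos hi, this, hXZ, C_neg]
        ring
      · have : i.castSucc = 0 := by
          ext; simp; omega
        rw [dif_neg hi, this, hX0]
        simp
  obtain ⟨E, G, hE, hG, hEG⟩ := exists_unimodular_reduction (matPoly A) (C α) (C α⁻¹)
    (by rw [← C_mul, mul_inv_cancel₀ hα, C_1]) Lb.toBlocks₂₁ T hT (Z.map (C : F →+* F[X]))
    (rectId F[X] j m n) (rectId F[X] j m n)ᵀ (rectId_mul_transpose hmn)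
    (H.map (C : F →+* F[X]))
    (by
      rw [← RingHom.mapMatrix_apply, ← RingHom.map_det]
      exact ((Matrix.isUnit_iff_isUnit_det _).1 hH).map C)
    (by rw [← Matrix.map_mul, hZH, hmap])
  refine isGLin_of_blocks (Fin.last j) (E := E * V) (G := G) ?_ hG ?_
  · rw [Matrix.det_mul, show V = Matrix.fromBlocks 1 U 0 1 from rfl,
      Matrix.det_fromBlocks_zero₂₁]
    simpa using hE
  · rw [Matrix.mul_assoc E, ← hLb, hU, hEG]

lemma pencil_mul_map {ρ γ : Type*} [Fintype γ] (Xc Yc : Matrix ρ γ F) (K : Matrix γ γ F) :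
    pencil Xc Yc * K.map (C : F →+* F[X]) = pencil (Xc * K) (Yc * K) := by
  ext i q : 1
  simp only [pencil, Matrix.mul_apply, Matrix.of_apply, Matrix.map_apply, map_sum, Finset.sum_mul,
    ← Finset.sum_add_distrib, C_mul]
  exact Finset.sum_congr rfl fun l _ => by ring

lemma AnsatzCoeffs.isGLin {j m n : ℕ} (hmn : m ≤ n)
    {A : Fin (j + 1 + 1) → Matrix (Fin m) (Fin n) F}
    {Xc Yc : Matrix (Fin (j + 1) × Fin m) (Fin (j + 1) × Fin n) F} {w : Fin (j + 1) → F}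
    (h : AnsatzCoeffs A Xc Yc w) {M : Matrix (Fin (j + 1)) (Fin (j + 1)) F} (hM : IsUnit M)
    {α : F} (hα : α ≠ 0) (hMw : M.mulVec w = e1 α) (hZ : (Zmat2 M Yc).rank = j * m) :
    IsGLin (matPoly A) (pencil Xc Yc) := by
  have hK : IsUnit (kronId Mᵀ : Matrix (Fin (j + 1) × Fin n) (Fin (j + 1) × Fin n) F) :=
    isUnit_kronId ((Matrix.isUnit_transpose _).2 hM)
  refine IsGLin.of_mul_right (K := (kronId Mᵀ).map (C : F →+* F[X])) ?_ ?_
  · rw [← RingHom.mapMatrix_apply, ← RingHom.map_det]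
    exact ((Matrix.isUnit_iff_isUnit_det _).1 hK).map C
  · rw [pencil_mul_map]
    exact AnsatzCoeffs.isGLin_of_e1 hmn hα (hMw ▸ h.mul_kronId M) (Zmat2 M Yc)
      (fun i r l c => rfl) hZ

/-! ### reversals -/

lemma revMat_pencil {ρ γ : Type*} (Xc Yc : Matrix ρ γ F) :
    revMat 1 (pencil Xc Yc) = pencil Yc Xc := by
  ext i q : 1
  have h := reflect_C_mul_X_pow 1 1 (c := Xc i q)
  rw [pow_one] at h
  simp only [revMat, pencil, Matrix.map_apply, Matrix.of_apply, reflect_add, h, reflect_C]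
  simp [add_comm]

lemma revMat_matPoly {k m n : ℕ} (A : Fin (k + 1) → Matrix (Fin m) (Fin n) F) :
    revMat k (matPoly A) = matPoly (A ∘ Fin.rev) := by
  ext r c : 1
  have hsum : ∀ (s : Finset (Fin (k + 1))) (f : Fin (k + 1) → F[X]),
      reflect k (∑ i ∈ s, f i) = ∑ i ∈ s, reflect k (f i) := fun s f => by
    induction s using Finset.induction_on with
    | empty => simp
    | insert a s ha ih => rw [Finset.sum_insert ha, Finset.sum_insert ha, reflect_add, ih]
  simp only [revMat, matPoly, Matrix.map_apply, Matrix.of_apply, hsum, reflect_C_mul_X_pow]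
  refine (Equiv.sum_comp Fin.revPerm _).symm.trans ?_
  refine Finset.sum_congr rfl fun i _ => ?_
  rw [revAt_le (by omega)]
  simp only [Fin.revPerm_apply, Function.comp_apply, Fin.val_rev]
  congr 2
  omega

/-- In `αe₁`-form, the nonleading block columns of the leading coefficient are `-Ẑ`. -/
lemma AnsatzCoeffs.leading_eq_neg_Zmat2 {j m n : ℕ}
    {A : Fin (j + 1 + 1) → Matrix (Fin m) (Fin n) F}
    {Xc Yc : Matrix (Fin (j + 1) × Fin m) (Fin (j + 1) × Fin n) F} {w : Fin (j + 1) → F}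
    (h : AnsatzCoeffs A Xc Yc w) {M : Matrix (Fin (j + 1)) (Fin (j + 1)) F} {α : F}
    (hMw : M.mulVec w = e1 α) (i : Fin j) (r : Fin m) (l : Fin j) (c : Fin n) :
    (Xc * (kronId Mᵀ : Matrix (Fin (j + 1) × Fin n) (Fin (j + 1) × Fin n) F))
      (i.succ, r) (l.succ, c) = -Zmat2 M Yc (i, r) (l, c) := by
  have hm := (h.mul_kronId M).middle i r (l.succ, c)
  have h0 : M.mulVec w l.succ = 0 := by simp [hMw, e1]
  rw [h0, zero_mul] at hm
  exact eq_neg_of_add_eq_zero_right hm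

lemma AnsatzCoeffs.isStrongGLin {j m n : ℕ} (hmn : m ≤ n)
    {A : Fin (j + 1 + 1) → Matrix (Fin m) (Fin n) F}
    {Xc Yc : Matrix (Fin (j + 1) × Fin m) (Fin (j + 1) × Fin n) F} {w : Fin (j + 1) → F}
    (h : AnsatzCoeffs A Xc Yc w) {M : Matrix (Fin (j + 1)) (Fin (j + 1)) F} (hM : IsUnit M)
    {α : F} (hα : α ≠ 0) (hMw : M.mulVec w = e1 α) (hZ : (Zmat2 M Yc).rank = j * m) :
    IsStrongGLin A (pencil Xc Yc) := by
  refine ⟨h.isGLin hmn hM hα hMw hZ, ?_⟩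
  rw [revMat_pencil, revMat_matPoly]
  refine IsGLin.of_submatrix_rows (Fin.revPerm.prodCongr (Equiv.refl _))
    (h.reverse.isGLin hmn hM hα hMw ?_)
  have hrev : Zmat2 M (Xc.submatrix (Prod.map Fin.rev id) id) =
      (-Zmat2 M Yc).submatrix ((Fin.revPerm (n := j)).prodCongr (Equiv.refl (Fin m)))
        (Equiv.refl (Fin j × Fin n)) := by
    refine Matrix.ext fun ⟨i, r⟩ ⟨l, c⟩ => ?_
    have hX := h.leading_eq_neg_Zmat2 hMw i.rev r l c
    rw [← Fin.rev_castSucc] at hX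
    exact hX
  rw [hrev, Matrix.rank_submatrix, ← hZ, Matrix.rank, Matrix.rank,
    show (-Zmat2 M Yc).mulVecLin = -(Zmat2 M Yc).mulVecLin from LinearMap.ext fun v => by simp,
    LinearMap.range_neg]

/-- For `m ≤ n` and `L(λ) = λX + Y ∈ 𝕃₂(P)` with nonzero left ansatz
vector `w`: for any nonsingular `M̂` with `M̂w = α e₁` (`α ≠ 0`), the pencil `L(λ)(M̂ᵀ ⊗ I_n)`
has the block form `λ[[αA_k, 0],[X̂₁₂, −Ẑ]] + [[Ŷ₁₁, Ẑ],[αA₀, 0]]`; and if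
`rank Ẑ = (k−1)m` then `L(λ)` is a strong g-linearization of `P(λ)`. -/
theorem statement_3 {F : Type*} [RCLike F] {k m n : ℕ} (hk : 0 < k) (hmn : m ≤ n)
    (A : Fin (k + 1) → Matrix (Fin m) (Fin n) F)
    (Xc Yc : Matrix (Fin k × Fin m) (Fin k × Fin n) F)
    (w : Fin k → F) (hw : w ≠ 0)
    (hL : LeftAnsatz (matPoly A) (pencil Xc Yc) w)
    (M : Matrix (Fin k) (Fin k) F) (hM : IsUnit M)
    (α : F) (hα : α ≠ 0) (hMw : M.mulVec w = e1 α) :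
    (∃ (X12 Y11 : Matrix (Fin (k - 1) × Fin m) (Fin n) F),
      Xc * kronId Mᵀ = blk (α • A (Fin.last k)) 0 X12 (-(Zmat2 M Yc)) ∧
      Yc * kronId Mᵀ = blkY2 Y11 (Zmat2 M Yc) (α • A 0)) ∧
    ((Zmat2 M Yc).rank = (k - 1) * m → IsStrongGLin A (pencil Xc Yc)) := by
  obtain ⟨j, rfl⟩ : ∃ j, k = j + 1 := ⟨k - 1, by omega⟩
  have h := leftAnsatz_iff_ansatzCoeffs.1 hL
  refine ⟨?_, h.isStrongGLin hmn hM hα hMw⟩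
  have h' := h.mul_kronId M
  have hneg := h.leading_eq_neg_Zmat2 hMw
  rw [hMw] at h'
  generalize hX' : (Xc * (kronId Mᵀ : Matrix (Fin (j + 1) × Fin n) (Fin (j + 1) × Fin n) F)) = X'
    at h' hneg
  generalize hY' : (Yc * (kronId Mᵀ : Matrix (Fin (j + 1) × Fin n) (Fin (j + 1) × Fin n) F)) = Y'
    at h'
  refine ⟨Matrix.of fun p c => X' (Fin.succ p.1, p.2) (0, c),
    Matrix.of fun p c => Y' (Fin.castSucc p.1, p.2) (0, c), hX'.trans ?_, hY'.trans ?_⟩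
  · ext ⟨i, r⟩ ⟨l, c⟩
    induction i using Fin.cases with
    | zero => induction l using Fin.cases <;> simp [blk, h'.leading, e1]
    | succ i =>
      induction l using Fin.cases with
      | zero => rfl
      | succ l => exact hneg i r l c
  · ext ⟨i, r⟩ ⟨l, c⟩
    induction i using Fin.lastCases with
    | last => induction l using Fin.cases <;> simp [blkY2, h'.constant, e1]
    | cast i =>
      induction l using Fin.cases with
      | zero => simp [blkY2]
      | succ l =>
        rw [← hY']
        simp [blkY2, Zmat2]
        rfl

end GLin
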